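/- arXiv:2007.09667 — 2 statements merged into one kernel-verified Lean document; each statement's English description precedes it below -/
import Mathlib

section
/- Let α ∈ ℂ with Re α ≥ 0 and let φ be a convex analytic function on the unit disk with φ(0) = 1. If f is analytic on 𝔻 with f(0) = 0, f'(0) = 1, and f'(z) + α z f''(z) ≺ φ(z), then f'(z) ≺ ∫₀¹ φ(z ζ^α) dζ on 𝔻 (where ζ^α uses the principal branch). -/
open Metric

open Set Filter Topology

/-- An injective holomorphic function on the unit disk has a holomorphic left inverse. -/
lemma exists_differentiableAt_leftInverse {φ : ℂ → ℂ}
    (hφ : DifferentiableOn ℂ φ (ball 0 1)) (hinj : InjOn φ (ball 0 1)) :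
    ∃ ψ : ℂ → ℂ, ∀ z ∈ ball (0 : ℂ) 1, ψ (φ z) = z ∧ DifferentiableAt ℂ ψ (φ z) := by
  have hleft : ∀ z ∈ ball (0 : ℂ) 1, Function.invFunOn φ (ball 0 1) (φ z) = z :=
    fun z hz ↦ hinj.leftInvOn_invFunOn hz
  set ψ := Function.invFunOn φ (ball (0 : ℂ) 1)
  have han : AnalyticOnNhd ℂ φ (ball 0 1) := hφ.analyticOnNhd isOpen_ball
  have hopen : ∀ s ⊆ ball (0 : ℂ) 1, IsOpen s → IsOpen (φ '' s) := by
    refine (han.is_constant_or_isOpen (convex_ball 0 1).isPreconnected).resolve_left ?_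
    rintro ⟨c, hc⟩
    have h0 : (0 : ℂ) ∈ ball (0 : ℂ) 1 := by simp
    have h1 : (1 / 2 : ℂ) ∈ ball (0 : ℂ) 1 := by simp; norm_num
    have := hinj h0 h1 ((hc _ h0).trans (hc _ h1).symm)
    norm_num at this
  have hcont : ∀ z ∈ ball (0 : ℂ) 1, ContinuousAt ψ (φ z) := by
    intro z hz
    rw [ContinuousAt, hleft z hz, (nhds_basis_opens z).tendsto_right_iff]
    rintro V ⟨hzV, hV⟩
    filter_upwards [(hopen (V ∩ ball 0 1) inter_subset_right (hV.inter isOpen_ball)).mem_nhds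
      (mem_image_of_mem φ ⟨hzV, hz⟩)]
    rintro _ ⟨u, hu, rfl⟩
    rw [hleft u hu.2]
    exact hu.1
  have hdiff : ∀ z ∈ ball (0 : ℂ) 1, deriv φ z ≠ 0 → DifferentiableAt ℂ ψ (φ z) := by
    intro z hz hd
    have hd' : HasDerivAt φ (deriv φ z) (ψ (φ z)) := by
      rw [hleft z hz]
      exact (han z hz).differentiableAt.hasDerivAt
    refine (hd'.of_local_left_inverse (hcont z hz) hd ?_).differentiableAt
    filter_upwards [(hopen _ subset_rfl isOpen_ball).mem_nhds (mem_image_of_mem φ hz)]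
    rintro _ ⟨u, hu, rfl⟩
    rw [hleft u hu]
  refine ⟨ψ, fun z hz ↦ ⟨hleft z hz, ?_⟩⟩
  have hne : ∀ᶠ u in 𝓝[≠] z, deriv φ u ≠ 0 := by
    refine (han.deriv z hz).eventually_eq_zero_or_eventually_ne_zero.resolve_left fun h0 ↦ ?_
    obtain ⟨ε, hε, hsub⟩ := Metric.eventually_nhds_iff_ball.1
      (h0.and (isOpen_ball.mem_nhds hz))
    have hzε : z ∈ ball z ε := mem_ball_self hε
    have hconst {x y : ℂ} := isOpen_ball.is_const_of_deriv_eq_zero (convex_ball z ε).isPreconnected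
      (hφ.mono fun u hu ↦ (hsub u hu).2) (fun u hu ↦ (hsub u hu).1) (x := x) (y := y)
    have hu : z + (ε / 2 : ℝ) ∈ ball z ε := by
      simp [abs_of_pos hε]; linarith
    have := hinj (hsub _ hzε).2 (hsub _ hu).2 (hconst hzε hu)
    simp [hε.ne'] at this
  obtain ⟨V, hV, hVo, hzV⟩ := _root_.eventually_nhds_iff.1
    ((eventually_nhdsWithin_iff.1 hne).and (isOpen_ball.mem_nhds hz))
  have hW : φ '' V ∈ 𝓝 (φ z) :=
    (hopen V (fun u hu ↦ (hV u hu).2) hVo).mem_nhds (mem_image_of_mem φ hzV)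
  refine DifferentiableOn.differentiableAt
    ((Complex.differentiableOn_compl_singleton_and_continuousAt_iff hW).1 ⟨?_, hcont z hz⟩) hW
  rintro _ ⟨⟨u, hu, rfl⟩, hne⟩
  refine (hdiff u (hV u hu).2 ((hV u hu).1 ?_)).differentiableWithinAt
  rintro rfl
  exact hne rfl

/-- The derivative of an injective holomorphic function `φ` on the unit disk does not vanish,
and `φ` has a holomorphic left inverse. -/
lemma exists_hasDerivAt_leftInverse {φ : ℂ → ℂ}
    (hφ : DifferentiableOn ℂ φ (ball 0 1)) (hinj : InjOn φ (ball 0 1)) :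
    ∃ ψ : ℂ → ℂ, ∀ z ∈ ball (0 : ℂ) 1,
      ψ (φ z) = z ∧ deriv φ z ≠ 0 ∧ HasDerivAt ψ (deriv φ z)⁻¹ (φ z) := by
  obtain ⟨ψ, hψ⟩ := exists_differentiableAt_leftInverse hφ hinj
  refine ⟨ψ, fun z hz ↦ ?_⟩
  have hd := (hψ z hz).2.hasDerivAt
  have hcomp := (hd.comp z
    (hφ.differentiableAt (isOpen_ball.mem_nhds hz)).hasDerivAt).congr_of_eventuallyEq
    (f₁ := id) <| by
      filter_upwards [isOpen_ball.mem_nhds hz] with u hu using (hψ u hu).1.symm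
  have h1 := hcomp.unique (hasDerivAt_id z)
  exact ⟨(hψ z hz).1, right_ne_zero_of_mul (h1.trans_ne one_ne_zero),
    eq_inv_of_mul_eq_one_left h1 ▸ hd⟩

/-- A convex univalent function maps each disk centred at the origin into the half-plane
bounded by the tangent at a boundary point. -/
lemma re_sub_div_nonneg_of_convex {φ : ℂ → ℂ} (hφ : DifferentiableOn ℂ φ (ball 0 1))
    (hconv : Convex ℝ (φ '' ball 0 1)) (hinj : InjOn φ (ball 0 1)) {a v : ℂ}
    (ha : a ∈ ball (0 : ℂ) 1) (hva : ‖v‖ ≤ ‖a‖) :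
    0 ≤ ((φ a - φ v) / (a * deriv φ a)).re := by
  rcases eq_or_ne a 0 with rfl | ha0
  · simp
  obtain ⟨ψ, hψ⟩ := exists_hasDerivAt_leftInverse hφ hinj
  have hd0 := (hψ a ha).2.1
  set c := v / a
  have hc : ‖c‖ ≤ 1 := by
    rw [norm_div]; exact div_le_one_of_le₀ hva (norm_nonneg _)
  have hca : c * a = v := div_mul_cancel₀ v ha0
  have hcball : ∀ u ∈ ball (0 : ℂ) 1, c * u ∈ ball (0 : ℂ) 1 := by
    intro u hu
    rw [mem_ball_zero_iff] at hu ⊢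
    rw [norm_mul]
    nlinarith [norm_nonneg u]
  have hle : ∀ s ∈ Icc (0 : ℝ) 1, ‖ψ (φ a + s * (φ v - φ a))‖ ≤ ‖a‖ := by
    intro s hs
    have hmem : ∀ u ∈ ball (0 : ℂ) 1, φ u + s * (φ (c * u) - φ u) ∈ φ '' ball 0 1 := by
      intro u hu
      have := hconv (mem_image_of_mem φ hu) (mem_image_of_mem φ (hcball u hu))
        (sub_nonneg.2 hs.2) hs.1 (by ring)
      convert this using 1
      simp only [Complex.real_smul]
      push_cast
      ring
    have hS := Complex.norm_le_norm_of_mapsTo_ball (R := 1) (z := a)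
      (f := fun u ↦ ψ (φ u + s * (φ (c * u) - φ u))) ?_ ?_ ?_ (by simpa using ha)
    · simpa [hca] using hS
    · intro u hu
      obtain ⟨x, hx, hxe⟩ := hmem u hu
      have h1 : DifferentiableAt ℂ ψ (φ u + s * (φ (c * u) - φ u)) :=
        hxe ▸ (hψ x hx).2.2.differentiableAt
      have h2 : DifferentiableAt ℂ φ u := hφ.differentiableAt (isOpen_ball.mem_nhds hu)
      have h3 : DifferentiableAt ℂ (fun u ↦ φ (c * u)) u :=
        (hφ.differentiableAt (isOpen_ball.mem_nhds (hcball u hu))).comp u (by fun_prop)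
      exact (h1.comp u (f := fun u ↦ φ u + s * (φ (c * u) - φ u))
        (h2.add ((h3.sub h2).const_mul _))).differentiableWithinAt
    · intro u hu
      obtain ⟨x, hx, hxe⟩ := hmem u hu
      simp only [← hxe, (hψ x hx).1]
      exact ball_subset_closedBall hx
    · simp [(hψ 0 (by simp)).1]
  set X := (φ v - φ a) / deriv φ a with hX
  have hψd := (hψ a ha).2.2
  have hpath : HasDerivAt (fun s : ℝ ↦ ψ (φ a + s * (φ v - φ a))) X 0 := by
    have h1 : HasDerivAt (fun s : ℝ ↦ φ a + s * (φ v - φ a)) (φ v - φ a) 0 := by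
      simpa using ((Complex.ofRealCLM.hasDerivAt (x := 0)).mul_const (φ v - φ a)).const_add (φ a)
    have h2 : HasDerivAt ψ (deriv φ a)⁻¹ (φ a + (0 : ℝ) * (φ v - φ a)) := by simpa using hψd
    refine (h2.scomp (0 : ℝ) h1).congr_deriv ?_
    rw [hX, smul_eq_mul, div_eq_mul_inv]
  have hnorm := hpath.norm_sq
  have hnonpos : 2 * inner ℝ a X ≤ 0 := by
    have hmax : IsLocalMaxOn (fun s : ℝ ↦ ‖ψ (φ a + s * (φ v - φ a))‖ ^ 2) (Icc 0 1) 0 := by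
      refine IsMaxOn.localize fun s hs ↦ ?_
      have := hle s hs
      simp only [mem_ofPred_eq, Complex.ofReal_zero, zero_mul, add_zero, (hψ a ha).1]
      gcongr
    have := hmax.hasFDerivWithinAt_nonpos hnorm.hasFDerivAt.hasFDerivWithinAt (y := 1)
      (mem_posTangentConeAt_of_segment_subset (by simp [segment_eq_Icc]))
    simpa [(hψ a ha).1] using this
  have hkey : (φ a - φ v) / (a * deriv φ a) = -(X * (starRingEnd ℂ) a) / (‖a‖ ^ 2 : ℝ) := by
    have : ((‖a‖ ^ 2 : ℝ) : ℂ) = a * (starRingEnd ℂ) a := by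
      rw [Complex.mul_conj, Complex.normSq_eq_norm_sq]
    rw [this, hX]
    have : (starRingEnd ℂ) a ≠ 0 := by simpa using ha0
    field_simp
    ring
  rw [hkey, Complex.div_ofReal_re]
  refine div_nonneg ?_ (by positivity)
  rw [Complex.inner] at hnonpos
  simp only [Complex.neg_re]
  linarith

/-- First-order conditions at a point where a function attains its minimum over the disk
centred at the origin through that point. -/
lemma fderiv_of_isMinOn_closedBall {u : ℂ → ℝ} {L : ℂ →L[ℝ] ℝ} {z : ℂ}
    (hu : HasFDerivAt u L z) (hmin : ∀ v, ‖v‖ ≤ ‖z‖ → u z ≤ u v) :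
    L z ≤ 0 ∧ L (z * Complex.I) = 0 := by
  constructor
  · have hlocal : IsLocalMinOn u (closedBall 0 ‖z‖) z :=
      IsMinOn.localize fun v hv ↦ hmin v (by simpa using hv)
    have h := hlocal.hasFDerivWithinAt_nonneg hu.hasFDerivWithinAt (y := -z)
      (mem_posTangentConeAt_of_segment_subset
        ((convex_closedBall (0 : ℂ) ‖z‖).segment_subset (by simp) (by simp)))
    simpa using h
  · have hcircle : HasDerivAt (fun t : ℝ ↦ z * Complex.exp (t * Complex.I)) (z * Complex.I) 0 := by
      have h1 : HasDerivAt (fun t : ℝ ↦ (t : ℂ) * Complex.I) Complex.I 0 := by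
        simpa using (Complex.ofRealCLM.hasDerivAt (x := 0)).mul_const Complex.I
      simpa using h1.cexp.const_mul z
    have h2 : HasFDerivAt u L (z * Complex.exp ((0 : ℝ) * Complex.I)) := by simpa using hu
    refine IsLocalMin.hasDerivAt_eq_zero (Eventually.of_forall fun t ↦ ?_)
      (h2.comp_hasDerivAt (0 : ℝ) hcircle)
    simpa using hmin (z * Complex.exp (t * Complex.I)) (by simp)

/-- A first-order differential inequality of Miller–Mocanu type. -/
lemma re_nonneg_of_re_add_mul_deriv_nonneg {G R : ℂ → ℂ}
    (hG : DifferentiableOn ℂ G (ball 0 1)) (hR : ∀ z ∈ ball (0 : ℂ) 1, 0 ≤ (R z).re)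
    (h : ∀ z ∈ ball (0 : ℂ) 1, 0 ≤ (G z + R z * (z * deriv G z)).re) :
    ∀ z ∈ ball (0 : ℂ) 1, 0 ≤ (G z).re := by
  intro z₁ hz₁
  rw [mem_ball_zero_iff] at hz₁
  have hsub : closedBall (0 : ℂ) ‖z₁‖ ⊆ ball 0 1 := closedBall_subset_ball hz₁
  obtain ⟨z, hz, hmin⟩ := (isCompact_closedBall (0 : ℂ) ‖z₁‖).exists_isMinOn
    ⟨z₁, by simp⟩ (Complex.continuous_re.comp_continuousOn (hG.continuousOn.mono hsub))
  refine le_trans ?_ (hmin (show z₁ ∈ closedBall (0 : ℂ) ‖z₁‖ by simp))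
  have hd := (hG.differentiableAt (isOpen_ball.mem_nhds (hsub hz))).hasDerivAt
  have hu := Complex.reCLM.hasFDerivAt.comp z (hd.hasFDerivAt.restrictScalars ℝ)
  obtain ⟨h1, h2⟩ := fderiv_of_isMinOn_closedBall hu fun v hv ↦ hmin
    (mem_closedBall_zero_iff.2 (hv.trans (mem_closedBall_zero_iff.1 hz)))
  have him : (z * deriv G z).im = 0 := by
    simp at h2 ⊢
    linarith
  have hre : (z * deriv G z).re ≤ 0 := by simpa using h1
  have := h z (hsub hz)
  rw [Complex.add_re, Complex.mul_re, him] at this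
  simp only [Function.comp_apply] at this ⊢
  nlinarith [mul_nonneg (hR z (hsub hz)) (neg_nonneg.2 hre)]

/-- A holomorphic function with nonnegative real part on the disk and positive real part at the
origin has positive real part. -/
lemma re_pos_of_re_nonneg {H : ℂ → ℂ} (hH : DifferentiableOn ℂ H (ball 0 1))
    (hnonneg : ∀ z ∈ ball (0 : ℂ) 1, 0 ≤ (H z).re) (h0 : 0 < (H 0).re) :
    ∀ z ∈ ball (0 : ℂ) 1, 0 < (H z).re := by
  intro z hz
  refine (hnonneg z hz).lt_of_ne' fun hz0 ↦ ?_
  have hmax : IsMaxOn (norm ∘ fun u ↦ Complex.exp (-H u)) (ball 0 1) z := by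
    intro u hu
    simpa [Complex.norm_exp, hz0] using hnonneg u hu
  have := Complex.norm_eqOn_of_isPreconnected_of_isMaxOn (convex_ball (0 : ℂ) 1).isPreconnected
    isOpen_ball hH.neg.cexp hz hmax (mem_ball_self one_pos)
  simp [Complex.norm_exp, hz0] at this
  exact h0.ne' this

lemma norm_ofReal_cpow_le_one {α : ℂ} (hα : 0 ≤ α.re) {t : ℝ} (ht : t ∈ Ioc (0 : ℝ) 1) :
    ‖(t : ℂ) ^ α‖ ≤ 1 := by
  rw [Complex.norm_cpow_eq_rpow_re_of_pos ht.1]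
  exact Real.rpow_le_one ht.1.le ht.2 hα

lemma norm_mul_ofReal_cpow_le {α : ℂ} (hα : 0 ≤ α.re) (z : ℂ) {t : ℝ}
    (ht : t ∈ Ioc (0 : ℝ) 1) : ‖z * (t : ℂ) ^ α‖ ≤ ‖z‖ := by
  rw [norm_mul]
  exact mul_le_of_le_one_right (norm_nonneg z) (norm_ofReal_cpow_le_one hα ht)

lemma continuousOn_ofReal_cpow (α : ℂ) :
    ContinuousOn (fun t : ℝ ↦ (t : ℂ) ^ α) (Ioc 0 1) :=
  Complex.continuous_ofReal.continuousOn.cpow_const fun _ ht ↦ Or.inl (by simpa using ht.1)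

lemma continuousOn_comp_mul_cpow {α : ℂ} (hα : 0 ≤ α.re) {h : ℂ → ℂ}
    (hh : ContinuousOn h (ball 0 1)) {z : ℂ} (hz : z ∈ ball (0 : ℂ) 1) :
    ContinuousOn (fun t : ℝ ↦ h (z * (t : ℂ) ^ α)) (Ioc 0 1) :=
  hh.comp (continuousOn_const.mul (continuousOn_ofReal_cpow α)) fun _ ht ↦
    mem_ball_zero_iff.2 ((norm_mul_ofReal_cpow_le hα z ht).trans_lt (mem_ball_zero_iff.1 hz))

lemma exists_bound_of_continuousOn_ball {h : ℂ → ℂ} (hh : ContinuousOn h (ball 0 1)) {r : ℝ}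
    (hr : r < 1) : ∃ C, ∀ z, ‖z‖ ≤ r → ‖h z‖ ≤ C := by
  obtain ⟨C, hC⟩ := (isCompact_closedBall (0 : ℂ) r).exists_bound_of_continuousOn
    (hh.mono (closedBall_subset_ball hr))
  exact ⟨C, fun z hz ↦ hC z (by simpa using hz)⟩

lemma intervalIntegrable_of_norm_le {g : ℝ → ℂ} (hg : ContinuousOn g (Ioc 0 1)) {C : ℝ}
    (hC : ∀ t ∈ Ioc (0 : ℝ) 1, ‖g t‖ ≤ C) :
    IntervalIntegrable g MeasureTheory.volume 0 1 := by
  rw [intervalIntegrable_iff_integrableOn_Ioc_of_le zero_le_one]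
  exact MeasureTheory.IntegrableOn.of_bound (by simp)
    (hg.aestronglyMeasurable measurableSet_Ioc) C
    ((MeasureTheory.ae_restrict_iff' measurableSet_Ioc).2 (Eventually.of_forall hC))

lemma intervalIntegrable_comp_mul_cpow {α : ℂ} (hα : 0 ≤ α.re) {h : ℂ → ℂ}
    (hh : ContinuousOn h (ball 0 1)) {z : ℂ} (hz : z ∈ ball (0 : ℂ) 1) :
    IntervalIntegrable (fun t : ℝ ↦ h (z * (t : ℂ) ^ α)) MeasureTheory.volume 0 1 := by
  obtain ⟨C, hC⟩ := exists_bound_of_continuousOn_ball hh (mem_ball_zero_iff.1 hz)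
  exact intervalIntegrable_of_norm_le (continuousOn_comp_mul_cpow hα hh hz)
    fun t ht ↦ hC _ (norm_mul_ofReal_cpow_le hα z ht)

/-- The average `∫₀¹ φ(z t^α) dt`. -/
noncomputable def cpowAverage (α : ℂ) (φ : ℂ → ℂ) (z : ℂ) : ℂ :=
  ∫ t in (0 : ℝ)..1, φ (z * (t : ℂ) ^ α)

lemma hasDerivAt_cpowAverage {α : ℂ} (hα : 0 ≤ α.re) {φ : ℂ → ℂ}
    (hφ : DifferentiableOn ℂ φ (ball 0 1)) {z : ℂ} (hz : z ∈ ball (0 : ℂ) 1) :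
    IntervalIntegrable (fun t : ℝ ↦ deriv φ (z * (t : ℂ) ^ α) * (t : ℂ) ^ α)
      MeasureTheory.volume 0 1 ∧
    HasDerivAt (cpowAverage α φ)
      (∫ t in (0 : ℝ)..1, deriv φ (z * (t : ℂ) ^ α) * (t : ℂ) ^ α) z := by
  have hd : ContinuousOn (deriv φ) (ball 0 1) := (hφ.deriv isOpen_ball).continuousOn
  obtain ⟨r, hzr, hr⟩ := exists_between (mem_ball_zero_iff.1 hz)
  obtain ⟨C, hC⟩ := exists_bound_of_continuousOn_ball hd hr
  have hball : ball (0 : ℂ) r ⊆ ball 0 1 := ball_subset_ball hr.le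
  refine intervalIntegral.hasDerivAt_integral_of_dominated_loc_of_deriv_le
    (F := fun z (t : ℝ) ↦ φ (z * (t : ℂ) ^ α))
    (F' := fun z (t : ℝ) ↦ deriv φ (z * (t : ℂ) ^ α) * (t : ℂ) ^ α) (bound := fun _ ↦ C)
    (isOpen_ball.mem_nhds (mem_ball_zero_iff.2 hzr)) ?_
    (intervalIntegrable_comp_mul_cpow hα hφ.continuousOn hz) ?_ ?_ (by simp) ?_
  · filter_upwards [isOpen_ball.mem_nhds hz] with u hu
    rw [uIoc_of_le zero_le_one]
    exact (continuousOn_comp_mul_cpow hα hφ.continuousOn hu).aestronglyMeasurable measurableSet_Ioc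
  · rw [uIoc_of_le zero_le_one]
    exact ((continuousOn_comp_mul_cpow hα hd hz).mul
      (continuousOn_ofReal_cpow α)).aestronglyMeasurable measurableSet_Ioc
  · rw [uIoc_of_le zero_le_one]
    refine Eventually.of_forall fun t ht u hu ↦ ?_
    have h1 := norm_mul_ofReal_cpow_le hα u ht
    have h2 := hC _ (h1.trans (mem_ball_zero_iff.1 hu).le)
    rw [norm_mul]
    exact (mul_le_of_le_one_right (norm_nonneg _) (norm_ofReal_cpow_le_one hα ht)).trans h2
  · rw [uIoc_of_le zero_le_one]
    refine Eventually.of_forall fun t ht u hu ↦ ?_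
    have hmem : u * (t : ℂ) ^ α ∈ ball (0 : ℂ) 1 := mem_ball_zero_iff.2
      ((norm_mul_ofReal_cpow_le hα u ht).trans_lt (mem_ball_zero_iff.1 (hball hu)))
    exact (hφ.differentiableAt (isOpen_ball.mem_nhds hmem)).hasDerivAt.comp u
      (hasDerivAt_mul_const _)

lemma differentiableOn_cpowAverage {α : ℂ} (hα : 0 ≤ α.re) {φ : ℂ → ℂ}
    (hφ : DifferentiableOn ℂ φ (ball 0 1)) :
    DifferentiableOn ℂ (cpowAverage α φ) (ball 0 1) :=
  fun _ hz ↦ (hasDerivAt_cpowAverage hα hφ hz).2.differentiableAt.differentiableWithinAt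

/-- The differential equation satisfied by `cpowAverage`. -/
lemma cpowAverage_add_mul_deriv {α : ℂ} (hα : 0 ≤ α.re) {φ : ℂ → ℂ}
    (hφ : DifferentiableOn ℂ φ (ball 0 1)) {z : ℂ} (hz : z ∈ ball (0 : ℂ) 1) :
    cpowAverage α φ z + α * z * deriv (cpowAverage α φ) z = φ z := by
  obtain ⟨hint, hd⟩ := hasDerivAt_cpowAverage hα hφ hz
  have hint0 := intervalIntegrable_comp_mul_cpow hα hφ.continuousOn hz
  rw [hd.deriv, cpowAverage, ← intervalIntegral.integral_const_mul,
    ← intervalIntegral.integral_add hint0 (hint.const_mul _)]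
  have hcont := continuousOn_comp_mul_cpow hα hφ.continuousOn hz
  have key := intervalIntegral.integral_eq_sub_of_hasDerivAt_of_tendsto (a := 0) (b := 1)
    (f := fun t : ℝ ↦ (t : ℂ) * φ (z * (t : ℂ) ^ α)) (fa := 0) (fb := φ z) one_pos ?_
    (hint0.add (hint.const_mul (α * z))) ?_ ?_
  · rw [key, sub_zero]
  · intro t ht
    have hmem : z * (t : ℂ) ^ α ∈ ball (0 : ℂ) 1 := mem_ball_zero_iff.2
      ((norm_mul_ofReal_cpow_le hα z ⟨ht.1, ht.2.le⟩).trans_lt (mem_ball_zero_iff.1 hz))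
    have ht0 : (t : ℂ) ≠ 0 := by exact_mod_cast ht.1.ne'
    have h1 : HasDerivAt (fun x : ℂ ↦ z * x ^ α) (z * (α * (t : ℂ) ^ (α - 1))) (t : ℂ) := by
      simpa using ((hasDerivAt_id (t : ℂ)).cpow_const (c := α)
        (Or.inl (by simpa using ht.1))).const_mul z
    have h2 := (hφ.differentiableAt (isOpen_ball.mem_nhds hmem)).hasDerivAt.comp (t : ℂ) h1
    refine (((hasDerivAt_id (t : ℂ)).mul h2).comp_ofReal).congr_deriv ?_
    have h3 : (t : ℂ) ^ α = t * (t : ℂ) ^ (α - 1) := by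
      rw [Complex.cpow_sub _ _ ht0, Complex.cpow_one]
      field_simp
    simp only [id, Function.comp_apply]
    rw [h3]
    ring
  · obtain ⟨C, hC⟩ := exists_bound_of_continuousOn_ball hφ.continuousOn (mem_ball_zero_iff.1 hz)
    refine squeeze_zero_norm' (a := fun t : ℝ ↦ t * C) ?_ ?_
    · filter_upwards [Ioc_mem_nhdsGT one_pos] with t ht
      rw [norm_mul, Complex.norm_real, Real.norm_of_nonneg ht.1.le]
      exact mul_le_mul_of_nonneg_left (hC _ (norm_mul_ofReal_cpow_le hα z ht)) ht.1.le
    · have : Tendsto (fun t : ℝ ↦ t * C) (𝓝 0) (𝓝 (0 * C)) := (continuous_mul_const C).tendsto 0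
      rw [zero_mul] at this
      exact this.mono_left nhdsWithin_le_nhds
  · have h1 := (Complex.continuous_ofReal.continuousOn.mul hcont) 1 (right_mem_Ioc.2 one_pos)
    have h2 := h1.tendsto.mono_left
      (nhdsWithin_mono 1 (show Ioo (0 : ℝ) 1 ⊆ Ioc 0 1 from Ioo_subset_Ioc_self))
    rw [nhdsWithin_Ioo_eq_nhdsLT one_pos] at h2
    simpa [Pi.mul_def] using h2

/-- Differentiating the relation `q + α z q' = h`. -/
lemma deriv_add_mul_deriv_eq {α : ℂ} {q h : ℂ → ℂ} (hq : DifferentiableOn ℂ q (ball 0 1))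
    (hode : ∀ z ∈ ball (0 : ℂ) 1, q z + α * z * deriv q z = h z) {z h' : ℂ}
    (hz : z ∈ ball (0 : ℂ) 1) (hh : HasDerivAt h h' z) :
    deriv q z + α * (deriv q z + z * deriv (deriv q) z) = h' := by
  have hq1 := (hq.differentiableAt (isOpen_ball.mem_nhds hz)).hasDerivAt
  have hq2 := ((hq.deriv isOpen_ball).differentiableAt (isOpen_ball.mem_nhds hz)).hasDerivAt
  have h1 := hq1.add (((hasDerivAt_id z).const_mul α).mul hq2)
  have h2 := hh.congr_of_eventuallyEq (f₁ := fun z ↦ q z + α * z * deriv q z) <| by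
    filter_upwards [isOpen_ball.mem_nhds hz] with u hu using hode u hu
  rw [← h1.unique h2]
  simp only [id]
  ring

section ConvexAverage

variable {α : ℂ} {φ : ℂ → ℂ}

lemma one_add_mul_deriv_cpowAverage_zero (hα : 0 ≤ α.re)
    (hφ : DifferentiableOn ℂ φ (ball 0 1)) :
    (1 + α) * deriv (cpowAverage α φ) 0 = deriv φ 0 := by
  have h0 : (0 : ℂ) ∈ ball (0 : ℂ) 1 := mem_ball_self one_pos
  rw [← deriv_add_mul_deriv_eq (differentiableOn_cpowAverage hα hφ)
    (fun z hz ↦ cpowAverage_add_mul_deriv hα hφ hz) h0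
    (hφ.differentiableAt (isOpen_ball.mem_nhds h0)).hasDerivAt]
  ring

lemma re_mul_deriv_cpowAverage_div_pos (hα : 0 ≤ α.re) (hα0 : α ≠ 0)
    (hφ : DifferentiableOn ℂ φ (ball 0 1)) (hconv : Convex ℝ (φ '' ball 0 1))
    (hinj : InjOn φ (ball 0 1)) {a : ℂ} (ha : a ∈ ball (0 : ℂ) 1) :
    0 < (α * deriv (cpowAverage α φ) a / deriv φ a).re := by
  obtain ⟨_, hψ⟩ := exists_hasDerivAt_leftInverse hφ hinj
  have hα1 : 1 + α ≠ 0 := fun h ↦ by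
    have := congrArg Complex.re h
    simp at this
    linarith
  have hzero : 0 < (α * deriv (cpowAverage α φ) 0 / deriv φ 0).re := by
    have hne := (hψ 0 (mem_ball_self one_pos)).2.1
    rw [← one_add_mul_deriv_cpowAverage_zero hα hφ] at hne ⊢
    rw [mul_div_mul_right _ _ (right_ne_zero_of_mul hne), Complex.div_re, ← add_div]
    refine div_pos ?_ (Complex.normSq_pos.2 hα1)
    have := Complex.normSq_pos.2 hα0
    rw [Complex.normSq_apply] at this
    simp
    nlinarith
  refine re_pos_of_re_nonneg (H := fun a ↦ α * deriv (cpowAverage α φ) a / deriv φ a)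
    ((((differentiableOn_cpowAverage hα hφ).deriv isOpen_ball).const_mul α).div
      (hφ.deriv isOpen_ball) fun z hz ↦ (hψ z hz).2.1) (fun z hz ↦ ?_) hzero a ha
  rcases eq_or_ne z 0 with rfl | hz0
  · exact hzero.le
  have hint := intervalIntegrable_comp_mul_cpow hα hφ.continuousOn hz
  have heq : α * deriv (cpowAverage α φ) z / deriv φ z =
      ∫ t in (0 : ℝ)..1, (φ z - φ (z * (t : ℂ) ^ α)) / (z * deriv φ z) := by
    rw [intervalIntegral.integral_div, intervalIntegral.integral_sub (by simp) hint]
    have hode := cpowAverage_add_mul_deriv hα hφ hz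
    simp only [intervalIntegral.integral_const, sub_zero, one_smul]
    rw [cpowAverage] at hode
    rw [div_eq_div_iff (hψ z hz).2.1 (mul_ne_zero hz0 (hψ z hz).2.1)]
    linear_combination deriv φ z * hode
  rw [heq, ← Complex.reCLM_apply, ← Complex.reCLM.intervalIntegral_comp_comm
    ((intervalIntegrable_const.sub hint).div_const _)]
  refine intervalIntegral.integral_nonneg zero_le_one fun t ht ↦ ?_
  refine re_sub_div_nonneg_of_convex hφ hconv hinj hz ?_
  rcases ht.1.eq_or_lt with rfl | ht0
  · simp [Complex.zero_cpow hα0]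
  · exact norm_mul_ofReal_cpow_le hα z ⟨ht0, ht.2⟩

lemma deriv_cpowAverage_ne_zero (hα : 0 ≤ α.re) (hα0 : α ≠ 0)
    (hφ : DifferentiableOn ℂ φ (ball 0 1)) (hconv : Convex ℝ (φ '' ball 0 1))
    (hinj : InjOn φ (ball 0 1)) {a : ℂ} (ha : a ∈ ball (0 : ℂ) 1) :
    deriv (cpowAverage α φ) a ≠ 0 := fun h ↦ by
  simpa [h] using re_mul_deriv_cpowAverage_div_pos hα hα0 hφ hconv hinj ha

/-- Solutions `q` of `q + α z q' = φ ∘ v` with `‖v z‖ ≤ ‖z‖` lie in the half-planes supporting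
`cpowAverage α φ` on circles. -/
lemma re_cpowAverage_sub_div_pos (hα : 0 ≤ α.re) (hα0 : α ≠ 0)
    (hφ : DifferentiableOn ℂ φ (ball 0 1)) (hconv : Convex ℝ (φ '' ball 0 1))
    (hinj : InjOn φ (ball 0 1)) {q v : ℂ → ℂ} (hq : DifferentiableOn ℂ q (ball 0 1))
    (hv : DifferentiableOn ℂ v (ball 0 1)) (hvle : ∀ z ∈ ball (0 : ℂ) 1, ‖v z‖ ≤ ‖z‖)
    (hv1 : deriv v 0 ≠ 1)
    (hode : ∀ z ∈ ball (0 : ℂ) 1, q z + α * z * deriv q z = φ (v z)) {a : ℂ}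
    (ha : a ∈ ball (0 : ℂ) 1) (ha0 : a ≠ 0) :
    0 < ((cpowAverage α φ a - q a) / (a * deriv (cpowAverage α φ) a)).re := by
  have h0 : (0 : ℂ) ∈ ball (0 : ℂ) 1 := mem_ball_self one_pos
  have hΦ := differentiableOn_cpowAverage hα hφ
  have hΦode := fun z hz ↦ cpowAverage_add_mul_deriv (z := z) hα hφ hz
  have hΦ' := fun z hz ↦ deriv_cpowAverage_ne_zero (a := z) hα hα0 hφ hconv hinj hz
  have hR := fun z hz ↦ re_mul_deriv_cpowAverage_div_pos (a := z) hα hα0 hφ hconv hinj hz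
  have hΦ0 := one_add_mul_deriv_cpowAverage_zero hα hφ
  obtain ⟨_, hψ⟩ := exists_hasDerivAt_leftInverse hφ hinj
  set Φ := cpowAverage α φ
  have hv0 : v 0 = 0 := by simpa using hvle 0 h0
  set D : ℂ → ℂ := fun z ↦ Φ z - q z with hD
  have hDd : DifferentiableOn ℂ D (ball 0 1) := hΦ.sub hq
  have hD0 : D 0 = 0 := by
    have h1 := hΦode 0 h0
    have h2 := hode 0 h0
    simp only [mul_zero, zero_mul, add_zero, hv0] at h1 h2
    simp [hD, h1, h2]
  set G : ℂ → ℂ := fun z ↦ dslope D 0 z / deriv Φ z with hG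
  have hGd : DifferentiableOn ℂ G (ball 0 1) :=
    ((Complex.differentiableOn_dslope (isOpen_ball.mem_nhds h0)).2 hDd).div
      (hΦ.deriv isOpen_ball) hΦ'
  have hGD : ∀ z ∈ ball (0 : ℂ) 1, G z * (z * deriv Φ z) = D z := by
    intro z hz
    have := sub_smul_dslope D 0 z
    rw [hD0, sub_zero, sub_zero, smul_eq_mul] at this
    rw [← this, hG]
    field_simp [hΦ' z hz]
  have hG0 : 0 < (G 0).re := by
    have hq0 : deriv q 0 + α * (deriv q 0 + 0 * deriv (deriv q) 0) = deriv φ 0 * deriv v 0 := by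
      refine deriv_add_mul_deriv_eq hq hode h0 ?_
      have h1 := (hφ.differentiableAt (isOpen_ball.mem_nhds h0)).hasDerivAt
      rw [← hv0] at h1
      have := h1.comp (0 : ℂ) (hv.differentiableAt (isOpen_ball.mem_nhds h0)).hasDerivAt
      rwa [hv0] at this
    have hval : G 0 = 1 - deriv v 0 := by
      have h1 : deriv D 0 = deriv Φ 0 - deriv q 0 :=
        deriv_sub (hΦ.differentiableAt (isOpen_ball.mem_nhds h0))
          (hq.differentiableAt (isOpen_ball.mem_nhds h0))
      have hne : 1 + α ≠ 0 :=
        left_ne_zero_of_mul (hΦ0.trans_ne (hψ 0 h0).2.1)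
      simp only [hG, dslope_same, h1]
      rw [div_eq_iff (hΦ' 0 h0)]
      refine mul_left_cancel₀ hne ?_
      linear_combination deriv v 0 * hΦ0 - hq0
    have hnorm : ‖deriv v 0‖ ≤ 1 := by
      refine Complex.norm_deriv_le_one_of_mapsTo_ball (R := 1) hv (fun z hz ↦ ?_) one_pos
      rw [hv0, mem_closedBall_zero_iff]
      exact (hvle z hz).trans (mem_ball_zero_iff.1 hz).le
    rw [hval, Complex.sub_re, Complex.one_re, sub_pos]
    refine ((Complex.re_le_norm _).trans hnorm).lt_of_ne fun hre ↦ hv1 ?_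
    have hsq := Complex.sq_norm (deriv v 0)
    rw [Complex.normSq_apply, hre] at hsq
    refine Complex.ext hre ?_
    rw [Complex.one_im]
    nlinarith [norm_nonneg (deriv v 0), mul_self_nonneg (deriv v 0).im]
  have hnonneg : ∀ z ∈ ball (0 : ℂ) 1, 0 ≤ (G z).re := by
    refine re_nonneg_of_re_add_mul_deriv_nonneg hGd (fun z hz ↦ (hR z hz).le) fun z hz ↦ ?_
    rcases eq_or_ne z 0 with rfl | hz0
    · simpa using hG0.le
    have hkey : G z + α * deriv Φ z / deriv φ z * (z * deriv G z) =
        (φ z - φ (v z)) / (z * deriv φ z) := by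
      have hDderiv : deriv D z = deriv Φ z - deriv q z :=
        deriv_sub (hΦ.differentiableAt (isOpen_ball.mem_nhds hz))
          (hq.differentiableAt (isOpen_ball.mem_nhds hz))
      have h1 := (hGd.differentiableAt (isOpen_ball.mem_nhds hz)).hasDerivAt.mul
        ((hasDerivAt_id z).mul
          ((hΦ.deriv isOpen_ball).differentiableAt (isOpen_ball.mem_nhds hz)).hasDerivAt)
      have h2 := ((hDd.differentiableAt (isOpen_ball.mem_nhds hz)).hasDerivAt).congr_of_eventuallyEq
        (f₁ := fun z ↦ G z * (z * deriv Φ z)) <| by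
          filter_upwards [isOpen_ball.mem_nhds hz] with u hu using hGD u hu
      have h3 := h1.unique h2
      rw [hDderiv] at h3
      have h4 := deriv_add_mul_deriv_eq hΦ hΦode hz
        (hφ.differentiableAt (isOpen_ball.mem_nhds hz)).hasDerivAt
      have h5 := hΦode z hz
      have h6 := hode z hz
      have h7 := hGD z hz
      have hne := (hψ z hz).2.1
      simp only [id, Pi.mul_apply] at h3
      rw [eq_div_iff (mul_ne_zero hz0 hne)]
      field_simp
      simp only [hD] at h7
      linear_combination z * α * h3 + h5 - h6 - G z * z * h4 + h7
    rw [hkey]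
    exact re_sub_div_nonneg_of_convex hφ hconv hinj hz (hvle z hz)
  have hpos := re_pos_of_re_nonneg hGd hnonneg hG0 a ha
  rwa [eq_div_of_mul_eq (mul_ne_zero ha0 (hΦ' a ha)) (hGD a ha)] at hpos

lemma injOn_cpowAverage (hα : 0 ≤ α.re) (hα0 : α ≠ 0)
    (hφ : DifferentiableOn ℂ φ (ball 0 1)) (hconv : Convex ℝ (φ '' ball 0 1))
    (hinj : InjOn φ (ball 0 1)) : InjOn (cpowAverage α φ) (ball 0 1) := by
  have key : ∀ a ∈ ball (0 : ℂ) 1, ∀ b, ‖b‖ ≤ ‖a‖ →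
      cpowAverage α φ a = cpowAverage α φ b → a = b := by
    intro a ha b hba heq
    by_contra hne
    have ha0 : a ≠ 0 := by
      rintro rfl
      exact hne (by simpa [eq_comm] using hba)
    set c := b / a
    have hca : c * a = b := div_mul_cancel₀ b ha0
    have hc : ‖c‖ ≤ 1 := by
      rw [norm_div]; exact div_le_one_of_le₀ hba (norm_nonneg _)
    have hcle : ∀ z : ℂ, ‖c * z‖ ≤ ‖z‖ := fun z ↦ by
      rw [norm_mul]; exact mul_le_of_le_one_left (norm_nonneg z) hc
    have hcball : ∀ z ∈ ball (0 : ℂ) 1, c * z ∈ ball (0 : ℂ) 1 := fun z hz ↦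
      mem_ball_zero_iff.2 ((hcle z).trans_lt (mem_ball_zero_iff.1 hz))
    have hcd : deriv (fun z ↦ c * z) 0 = c := by simp
    have hpos := re_cpowAverage_sub_div_pos hα hα0 hφ hconv hinj
      (q := fun z ↦ cpowAverage α φ (c * z)) (v := fun z ↦ c * z)
      ((differentiableOn_cpowAverage hα hφ).comp (by fun_prop) hcball) (by fun_prop)
      (fun z _ ↦ hcle z) ?_ (fun z hz ↦ ?_) ha ha0
    · simp [hca, heq] at hpos
    · rw [hcd]
      intro h1
      exact hne (by rw [← hca, h1, one_mul])
    · rw [deriv_comp_mul_left, smul_eq_mul,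
        ← cpowAverage_add_mul_deriv hα hφ (hcball z hz)]
      ring
  intro a ha b hb heq
  rcases le_total ‖b‖ ‖a‖ with h | h
  · exact key a ha b h heq
  · exact (key b hb a h heq.symm).symm

/-- The value at a point of a solution of `p + α z p' ≺ φ` lies in the image of
`cpowAverage α φ`. -/
lemma mem_image_cpowAverage (hα : 0 ≤ α.re) (hα0 : α ≠ 0)
    (hφ : DifferentiableOn ℂ φ (ball 0 1)) (hconv : Convex ℝ (φ '' ball 0 1))
    (hinj : InjOn φ (ball 0 1)) {p w : ℂ → ℂ} (hp : DifferentiableOn ℂ p (ball 0 1))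
    (hw : DifferentiableOn ℂ w (ball 0 1)) (hw0 : w 0 = 0)
    (hw1 : ∀ z ∈ ball (0 : ℂ) 1, ‖w z‖ < 1)
    (hode : ∀ z ∈ ball (0 : ℂ) 1, p z + α * z * deriv p z = φ (w z)) {z : ℂ}
    (hz : z ∈ ball (0 : ℂ) 1) : p z ∈ cpowAverage α φ '' ball 0 1 := by
  obtain ⟨r, hzr, hr⟩ := exists_between (mem_ball_zero_iff.1 hz)
  have hr0 : 0 < r := (norm_nonneg z).trans_lt hzr
  have hsub : closedBall (0 : ℂ) r ⊆ ball 0 1 := closedBall_subset_ball hr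
  have hΦ := differentiableOn_cpowAverage hα hφ
  obtain ⟨a, ha, hmin⟩ := (isCompact_closedBall (0 : ℂ) r).exists_isMinOn
    ⟨0, by simpa using hr0.le⟩
    (((hΦ.continuousOn.mono hsub).sub continuousOn_const).norm.pow 2 :
      ContinuousOn (fun u ↦ ‖cpowAverage α φ u - p z‖ ^ 2) (closedBall 0 r))
  refine ⟨a, hsub ha, ?_⟩
  have hΦa := deriv_cpowAverage_ne_zero hα hα0 hφ hconv hinj (hsub ha)
  have hd := ((hΦ.differentiableAt (isOpen_ball.mem_nhds (hsub ha))).hasDerivAt.sub_const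
    (p z)).hasFDerivAt.restrictScalars ℝ
  have hu := hd.norm_sq
  by_contra hne
  have hX : cpowAverage α φ a - p z ≠ 0 := sub_ne_zero.2 hne
  rcases (mem_closedBall_zero_iff.1 ha).lt_or_eq with har | har
  · have hcrit := (hmin.isLocalMin (closedBall_mem_nhds_of_mem
      (mem_ball_zero_iff.2 har))).hasFDerivAt_eq_zero hu
    have := congrArg (fun L : ℂ →L[ℝ] ℝ ↦
      L ((cpowAverage α φ a - p z) / deriv (cpowAverage α φ) a)) hcrit
    exact hX (by simpa [div_mul_cancel₀ _ hΦa, -Complex.inner, -map_sub] using this)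
  · obtain ⟨h1, h2⟩ := fderiv_of_isMinOn_closedBall hu fun v hv ↦
      hmin (mem_closedBall_zero_iff.2 (hv.trans har.le))
    have ha0 : a ≠ 0 := norm_pos_iff.1 (har ▸ hr0)
    set c := z / a
    have hca : c * a = z := div_mul_cancel₀ z ha0
    have hc : ‖c‖ < 1 := by
      rw [norm_div, har]; exact (div_lt_one hr0).2 hzr
    have hcle : ∀ z : ℂ, ‖c * z‖ ≤ ‖c‖ * ‖z‖ := fun z ↦ (norm_mul c z).le
    have hcball : ∀ z ∈ ball (0 : ℂ) 1, c * z ∈ ball (0 : ℂ) 1 := fun z hz ↦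
      mem_ball_zero_iff.2 <| by
        rw [mem_ball_zero_iff] at hz
        rw [norm_mul]
        nlinarith [norm_nonneg z]
    have hwle : ∀ z ∈ ball (0 : ℂ) 1, ‖w z‖ ≤ ‖z‖ := fun z hz ↦
      Complex.norm_le_norm_of_mapsTo_ball (R := 1) hw
        (fun u hu ↦ mem_closedBall_zero_iff.2 (hw1 u hu).le) hw0 (mem_ball_zero_iff.1 hz)
    have hvd : DifferentiableOn ℂ (fun z ↦ w (c * z)) (ball 0 1) :=
      hw.comp (by fun_prop) hcball
    have hvle : ∀ z ∈ ball (0 : ℂ) 1, ‖w (c * z)‖ ≤ ‖c‖ * ‖z‖ := fun z hz ↦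
      (hwle _ (hcball z hz)).trans (hcle z)
    have hpos := re_cpowAverage_sub_div_pos hα hα0 hφ hconv hinj
      (q := fun z ↦ p (c * z)) (v := fun z ↦ w (c * z))
      (hp.comp (by fun_prop) hcball) hvd
      (fun z hz ↦ (hvle z hz).trans (mul_le_of_le_one_left (norm_nonneg z) hc.le))
      ?_ (fun z hz ↦ ?_) (hsub ha) ha0
    · simp only [hca] at hpos
      set X := cpowAverage α φ a - p z
      set E := a * deriv (cpowAverage α φ) a with hE
      rw [Complex.div_re, ← add_div] at hpos
      have hE0 : 0 < Complex.normSq E := Complex.normSq_pos.2 (mul_ne_zero ha0 hΦa)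
      have := (div_pos_iff_of_pos_right hE0).1 hpos
      simp [Complex.inner] at h1
      rw [hE, Complex.mul_re, Complex.mul_im] at this
      nlinarith
    · intro h
      have hle : ‖deriv (fun z ↦ w (c * z)) 0‖ ≤ ‖c‖ / 1 := by
        refine Complex.norm_deriv_le_div_of_mapsTo_ball (R₁ := 1) hvd (fun u hu ↦ ?_) one_pos
        rw [mul_zero, hw0, mem_closedBall_zero_iff]
        exact (hvle u hu).trans
          (mul_le_of_le_one_right (norm_nonneg c) (mem_ball_zero_iff.1 hu).le)
      rw [h, norm_one, div_one] at hle
      exact hc.not_ge hle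
    · rw [deriv_comp_mul_left, smul_eq_mul, ← hode _ (hcball z hz)]
      ring

end ConvexAverage

/-- If `φ` is convex analytic on the unit disk with `φ(0) = 1`, `Re α ≥ 0`, and
`f' + α z f'' ≺ φ`, then `f'(z) ≺ ∫₀¹ φ(z ζ^α) dζ`. -/
theorem deriv_subordinate_integral (α : ℂ) (hα : 0 ≤ α.re) (φ f : ℂ → ℂ)
    (hφ : DifferentiableOn ℂ φ (ball 0 1))
    (hφ0 : φ 0 = 1)
    (hφconv : Convex ℝ (φ '' ball 0 1))
    (hφinj : Set.InjOn φ (ball 0 1))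
    (hf : DifferentiableOn ℂ f (ball 0 1))
    (hf0 : f 0 = 0) (hf'0 : deriv f 0 = 1)
    (hsub : ∃ w : ℂ → ℂ, DifferentiableOn ℂ w (ball 0 1) ∧ w 0 = 0 ∧
      (∀ z ∈ ball (0:ℂ) 1, ‖w z‖ < 1) ∧
      ∀ z ∈ ball (0:ℂ) 1, deriv f z + α * z * deriv (deriv f) z = φ (w z)) :
    ∃ ω : ℂ → ℂ, DifferentiableOn ℂ ω (ball 0 1) ∧ ω 0 = 0 ∧
      (∀ z ∈ ball (0:ℂ) 1, ‖ω z‖ < 1) ∧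
      ∀ z ∈ ball (0:ℂ) 1,
        deriv f z = ∫ ζ in (0:ℝ)..1, φ (ω z * (ζ : ℂ) ^ α) := by
  obtain ⟨w, hw, hw0, hw1, hode⟩ := hsub
  rcases eq_or_ne α 0 with rfl | hα0
  · exact ⟨w, hw, hw0, hw1, fun z hz ↦ by simpa using hode z hz⟩
  have hp : DifferentiableOn ℂ (deriv f) (ball 0 1) := hf.deriv isOpen_ball
  have hΦ := differentiableOn_cpowAverage hα hφ
  obtain ⟨ψ, hψ⟩ := exists_hasDerivAt_leftInverse hΦ
    (injOn_cpowAverage hα hα0 hφ hφconv hφinj)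
  have hmem := fun z hz ↦
    mem_image_cpowAverage (z := z) hα hα0 hφ hφconv hφinj hp hw hw0 hw1 hode hz
  refine ⟨fun z ↦ ψ (deriv f z), fun z hz ↦ ?_, ?_, fun z hz ↦ ?_, fun z hz ↦ ?_⟩
  · obtain ⟨u, hu, hue⟩ := hmem z hz
    have h1 : DifferentiableAt ℂ ψ (deriv f z) := hue ▸ (hψ u hu).2.2.differentiableAt
    exact (h1.comp z (hp.differentiableAt (isOpen_ball.mem_nhds hz))).differentiableWithinAt
  · have h0 : cpowAverage α φ 0 = deriv f 0 := by simp [cpowAverage, hφ0, hf'0]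
    simpa [h0] using (hψ 0 (mem_ball_self one_pos)).1
  · obtain ⟨u, hu, hue⟩ := hmem z hz
    simpa [← hue, (hψ u hu).1] using hu
  · obtain ⟨u, hu, hue⟩ := hmem z hz
    simp only [← hue, (hψ u hu).1]
    rfl
end

section
/- For α ∈ ℂ with Re α ≥ 0, the function Φ_α(z) = ∫₀¹ dt/(1 - z t^α) = ∑_{n≥0} z^n/(1 + nα) is a convex univalent function on the unit disk. -/
open Metric
open Filter Topology

lemma re_conj_mul_add_normSq_pos {ζ v a b : ℂ} (hζ : ζ ≠ 0) (hv : v ≠ 0)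
    (hab : 0 < ((starRingEnd ℂ) a * (a + ζ * b)).re) (h : ((starRingEnd ℂ) ζ * v).re = 0) :
    0 < ((starRingEnd ℂ) ζ * (-(v ^ 2 * b / a))).re + Complex.normSq v := by
  have ha : a ≠ 0 := by rintro rfl; simp at hab
  set κ := ((starRingEnd ℂ) ζ * v).im with hκ
  have hx : (starRingEnd ℂ) ζ * v = κ * Complex.I := by
    apply Complex.ext <;> simp [h, hκ]
  have hκ0 : κ ≠ 0 := by
    intro h0
    rw [h0] at hx
    simp [hζ, hv] at hx
  have hsum : (Complex.normSq ζ : ℂ) * ((starRingEnd ℂ) ζ * (-(v ^ 2 * b / a)))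
      = (κ ^ 2 : ℝ) * (ζ * b / a) := by
    have : (Complex.normSq ζ : ℂ) * ((starRingEnd ℂ) ζ * (-(v ^ 2 * b / a)))
      = -((starRingEnd ℂ) ζ * v) ^ 2 * (ζ * b / a) := by
      rw [← Complex.mul_conj]; ring
    rw [this, hx, mul_pow, Complex.I_sq]; push_cast; ring
  have hv2 : Complex.normSq ζ * Complex.normSq v = κ ^ 2 := by
    have := congrArg Complex.normSq hx
    simpa [Complex.normSq_mul, sq] using this
  have hre : 0 < 1 + (ζ * b / a).re := by
    have e : (starRingEnd ℂ) a * (a + ζ * b) = (Complex.normSq a : ℂ) * (1 + ζ * b / a) := by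
      rw [← Complex.mul_conj]; field_simp
    rw [e, Complex.re_ofReal_mul] at hab
    simpa using (pos_iff_pos_of_mul_pos hab).1 (Complex.normSq_pos.2 ha)
  have h1 := congrArg Complex.re hsum
  rw [Complex.re_ofReal_mul, Complex.re_ofReal_mul] at h1
  have hn := Complex.normSq_pos.2 hζ
  refine (pos_iff_pos_of_mul_pos (a := Complex.normSq ζ) ?_).1 hn
  rw [mul_add, h1, hv2]
  have : 0 < κ ^ 2 := by positivity
  nlinarith

lemma not_isLocalMax_of_deriv_deriv_pos {h : ℝ → ℝ} {s : ℝ} (h2 : 0 < deriv (deriv h) s)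
    (hc : ContinuousAt h s) : ¬ IsLocalMax h s := by
  intro hmax
  have hmin := isLocalMin_of_deriv_deriv_pos h2 hmax.deriv_eq_zero hc
  have he : h =ᶠ[𝓝 s] fun _ => h s := by
    filter_upwards [hmax, hmin] with x h1 h2 using le_antisymm h1 h2
  have := he.deriv.deriv_eq
  simp at this
  linarith

section

variable {f : ℂ → ℂ} {U : Set ℂ}

lemma hasDerivAt_invFunOn (hU : IsOpen U) (hf : DifferentiableOn ℂ f U) (hinj : Set.InjOn f U)
    (hd : ∀ z ∈ U, deriv f z ≠ 0) {z : ℂ} (hz : z ∈ U) :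
    HasDerivAt (Function.invFunOn f U) (deriv f z)⁻¹ (f z) := by
  have hs : HasStrictDerivAt f (deriv f z) z :=
    (hf.analyticAt (hU.mem_nhds hz)).hasStrictDerivAt
  have hmap := hs.map_nhds_eq (hd z hz)
  have hleft : ∀ x ∈ U, Function.invFunOn f U (f x) = x := hinj.leftInvOn_invFunOn
  have hU' := hU.mem_nhds hz
  refine HasDerivAt.of_local_left_inverse (f := f) ?_ ?_ (hd z hz) ?_
  · rw [ContinuousAt, hleft z hz, ← hmap, tendsto_map'_iff]
    refine tendsto_id.congr' ?_
    filter_upwards [hU'] with x hx using (hleft x hx).symm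
  · rw [hleft z hz]; exact hs.hasDerivAt
  · rw [← hmap, eventually_map]
    filter_upwards [hU'] with x hx
    rw [hleft x hx]

lemma isOpen_image_of_deriv_ne_zero (hU : IsOpen U) (hf : DifferentiableOn ℂ f U)
    (hd : ∀ z ∈ U, deriv f z ≠ 0) : IsOpen (f '' U) := by
  rw [isOpen_iff_mem_nhds]
  rintro _ ⟨z, hz, rfl⟩
  rw [← (hf.analyticAt (hU.mem_nhds hz)).hasStrictDerivAt.map_nhds_eq (hd z hz)]
  exact image_mem_map (hU.mem_nhds hz)

/-- Under the analytic convexity condition, the norm of the preimage of a point moving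
along a line has no local maximum away from the origin. -/
lemma not_isLocalMax_norm_sq_invFunOn (hU : IsOpen U) (hf : DifferentiableOn ℂ f U)
    (hinj : Set.InjOn f U)
    (hp : ∀ z ∈ U, 0 < ((starRingEnd ℂ) (deriv f z) * (deriv f z + z * deriv (deriv f) z)).re)
    {w Δ : ℂ} (hΔ : Δ ≠ 0) {s : ℝ} (hs : w + s * Δ ∈ f '' U)
    (h0 : Function.invFunOn f U (w + s * Δ) ≠ 0) :
    ¬ IsLocalMax (fun s : ℝ => ‖Function.invFunOn f U (w + s * Δ)‖ ^ 2) s := by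
  have hd : ∀ z ∈ U, deriv f z ≠ 0 := by
    intro z hz h; simpa [h] using hp z hz
  set g := Function.invFunOn f U with hg
  set ζ : ℝ → ℂ := fun s => g (w + s * Δ) with hζ
  have hmem : ∀ y ∈ f '' U, g y ∈ U := fun y hy => Function.invFunOn_mem hy
  have hr : ∀ y ∈ f '' U, f (g y) = y := fun y hy => Function.invFunOn_eq hy
  have hline : ∀ t : ℝ, HasDerivAt (fun t : ℝ => w + t * Δ) Δ t := by
    intro t
    simpa using ((Complex.ofRealCLM.hasDerivAt (x := t)).mul_const Δ).const_add w
  have hζd : ∀ t : ℝ, w + t * Δ ∈ f '' U → HasDerivAt ζ (Δ / deriv f (ζ t)) t := by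
    intro t ht
    have h1 := hasDerivAt_invFunOn hU hf hinj hd (hmem _ ht)
    rw [hr _ ht] at h1
    have := h1.scomp t (hline t)
    rwa [smul_eq_mul, ← div_eq_mul_inv] at this
  have hev : ∀ᶠ t : ℝ in 𝓝 s, w + t * Δ ∈ f '' U :=
    (hline s).continuousAt.eventually_mem ((isOpen_image_of_deriv_ne_zero hU hf hd).mem_nhds hs)
  have hdh : deriv (fun s : ℝ => ‖ζ s‖ ^ 2) =ᶠ[𝓝 s]
      fun t => 2 * inner ℝ (ζ t) (Δ / deriv f (ζ t)) := by
    filter_upwards [hev] with t ht using (hζd t ht).norm_sq.deriv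
  intro hmax
  have hcrit : inner ℝ (ζ s) (Δ / deriv f (ζ s)) = (0:ℝ) := by
    have := hmax.deriv_eq_zero
    rw [hdh.self_of_nhds] at this
    linarith
  have hz := hmem _ hs
  have hA : HasDerivAt (deriv f) (deriv (deriv f) (ζ s)) (ζ s) :=
    ((hf.analyticAt (hU.mem_nhds hz)).deriv.differentiableAt).hasDerivAt
  have hv : HasDerivAt (fun t => Δ / deriv f (ζ t))
      (-((Δ / deriv f (ζ s)) ^ 2 * deriv (deriv f) (ζ s) / deriv f (ζ s))) s := by
    have h1 := hA.comp_of_eq s (hζd s hs) rfl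
    have h2 := (hasDerivAt_const s Δ).div h1 (hd _ hz)
    refine h2.congr_deriv ?_
    have : deriv f (ζ s) ≠ 0 := hd _ hz
    simp only [Function.comp_apply]
    field_simp
    simp
  refine not_isLocalMax_of_deriv_deriv_pos ?_ (hζd s hs).norm_sq.continuousAt hmax
  rw [hdh.deriv_eq, (((hζd s hs).inner ℝ hv).const_mul 2).deriv]
  have key := re_conj_mul_add_normSq_pos h0 (div_ne_zero hΔ (hd _ hz)) (hp _ hz)
    (by rw [← hcrit, Complex.inner, mul_comm])
  rw [Complex.inner, Complex.inner]
  rw [Complex.mul_conj, Complex.ofReal_re]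
  rw [mul_comm ((starRingEnd ℂ) _)] at key
  linarith

end

/-- The analytic characterization of convexity implies convexity of the image. -/
theorem convex_image_ball_of_re_pos {f : ℂ → ℂ} (hf : DifferentiableOn ℂ f (ball 0 1))
    (hinj : Set.InjOn f (ball 0 1))
    (hp : ∀ z ∈ ball (0:ℂ) 1,
      0 < ((starRingEnd ℂ) (deriv f z) * (deriv f z + z * deriv (deriv f) z)).re) :
    Convex ℝ (f '' ball 0 1) := by
  have hd : ∀ z ∈ ball (0:ℂ) 1, deriv f z ≠ 0 := by
    intro z hz h; simpa [h] using hp z hz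
  have hleft : ∀ x ∈ ball (0:ℂ) 1, Function.invFunOn f (ball 0 1) (f x) = x :=
    hinj.leftInvOn_invFunOn
  have hO := isOpen_image_of_deriv_ne_zero isOpen_ball hf hd
  have hquasi : ∀ r < 1, ∀ z₁ ∈ closedBall (0:ℂ) r, ∀ z₂ ∈ closedBall (0:ℂ) r,
      (∀ s : unitInterval, f z₁ + (s:ℝ) * (f z₂ - f z₁) ∈ f '' ball 0 1) →
      ∀ s : unitInterval, f z₁ + (s:ℝ) * (f z₂ - f z₁) ∈ f '' closedBall 0 r := by
    intro r hr z₁ hz₁ z₂ hz₂ h s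
    have hsub : closedBall (0:ℂ) r ⊆ ball 0 1 := closedBall_subset_ball hr
    rcases eq_or_ne (f z₂ - f z₁) 0 with hΔ | hΔ
    · rw [hΔ]; simpa using ⟨z₁, by simpa using hz₁, rfl⟩
    have hr0 : 0 ≤ r := (norm_nonneg z₁).trans (by simpa using hz₁)
    set g := Function.invFunOn f (ball 0 1) with hg
    set k : ℝ → ℝ := fun s => ‖g (f z₁ + s * (f z₂ - f z₁))‖ ^ 2 with hk
    have hgc : ContinuousOn g (f '' ball 0 1) := by
      rintro _ ⟨z, hz, rfl⟩
      exact (hasDerivAt_invFunOn isOpen_ball hf hinj hd hz).continuousAt.continuousWithinAt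
    have hkc : ContinuousOn k (Set.Icc 0 1) := by
      refine ((hgc.comp (by fun_prop) ?_).norm).pow 2
      intro x hx
      exact h ⟨x, hx⟩
    obtain ⟨m, hm, hmax⟩ := isCompact_Icc.exists_isMaxOn ⟨0, by simp⟩ hkc
    have hkm : k m ≤ r ^ 2 := by
      by_contra! hlt
      have hk0 : k 0 ≤ r ^ 2 := by
        simp only [hk, Complex.ofReal_zero, zero_mul, add_zero]
        rw [hleft _ (hsub hz₁)]
        exact pow_le_pow_left₀ (norm_nonneg _) (by simpa using hz₁) 2
      have hk1 : k 1 ≤ r ^ 2 := by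
        simp only [hk, Complex.ofReal_one, one_mul, add_sub_cancel]
        rw [hleft _ (hsub hz₂)]
        exact pow_le_pow_left₀ (norm_nonneg _) (by simpa using hz₂) 2
      have hm0 : 0 < m := lt_of_le_of_ne hm.1 (by rintro rfl; linarith)
      have hm1 : m < 1 := lt_of_le_of_ne hm.2 (by rintro rfl; linarith)
      refine not_isLocalMax_norm_sq_invFunOn isOpen_ball hf hinj hp hΔ (h ⟨m, hm⟩) ?_
        (hmax.isLocalMax (Icc_mem_nhds hm0 hm1))
      intro h0
      have : k m = 0 := by simpa [hk] using h0
      nlinarith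
    refine ⟨g (f z₁ + (s:ℝ) * (f z₂ - f z₁)), ?_, Function.invFunOn_eq (h s)⟩
    have : k s ≤ r ^ 2 := (hmax s.2).trans hkm
    simpa using abs_le_of_sq_le_sq' this hr0 |>.2
  rw [convex_iff_segment_subset]
  rintro _ ⟨z₁, hz₁, rfl⟩ _ ⟨z₂, hz₂, rfl⟩
  obtain ⟨r, hr, hr1, hr2⟩ : ∃ r < 1, ‖z₁‖ ≤ r ∧ ‖z₂‖ ≤ r :=
    ⟨max ‖z₁‖ ‖z₂‖, max_lt (by simpa using hz₁) (by simpa using hz₂), le_max_left _ _, le_max_right _ _⟩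
  have hsub : closedBall (0:ℂ) r ⊆ ball 0 1 := closedBall_subset_ball hr
  have hscale : ∀ z : ℂ, ‖z‖ ≤ r → ∀ t : unitInterval, ((t:ℝ):ℂ) * z ∈ closedBall (0:ℂ) r := by
    intro z hz t
    have h1 : |(t:ℝ)| ≤ 1 := abs_le.2 ⟨by linarith [t.2.1], t.2.2⟩
    simp only [mem_closedBall, dist_zero_right, norm_mul, Complex.norm_real, Real.norm_eq_abs]
    nlinarith [norm_nonneg z, abs_nonneg (t:ℝ)]
  have hfc : ∀ z : ℂ, ‖z‖ ≤ r → Continuous fun t : unitInterval => f (((t:ℝ):ℂ) * z) := by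
    intro z hz
    exact hf.continuousOn.comp_continuous (by fun_prop) fun t => hsub (hscale z hz t)
  set W : unitInterval → unitInterval → ℂ := fun t s =>
    f (((t:ℝ):ℂ) * z₁) + (s:ℝ) * (f (((t:ℝ):ℂ) * z₂) - f (((t:ℝ):ℂ) * z₁)) with hW
  have hc1 := hfc z₁ hr1
  have hc2 := hfc z₂ hr2
  have hWc : Continuous fun p : unitInterval × unitInterval => W p.1 p.2 := by
    have h1 := hc1.comp (continuous_fst (X := unitInterval) (Y := unitInterval))
    have h2 := hc2.comp (continuous_fst (X := unitInterval) (Y := unitInterval))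
    have h3 : Continuous fun p : unitInterval × unitInterval => (((p.2 : ℝ)) : ℂ) := by fun_prop
    exact h1.add (h3.mul (h2.sub h1))
  have hclopen : IsClopen {t : unitInterval | ∀ s, W t s ∈ f '' ball 0 1} := by
    constructor
    · have heq : {t : unitInterval | ∀ s, W t s ∈ f '' ball 0 1}
          = ⋂ s, {t : unitInterval | W t s ∈ f '' closedBall 0 r} := by
        ext t
        simp only [Set.mem_ofPred_eq, Set.mem_iInter]
        exact ⟨fun h => hquasi r hr _ (hscale z₁ hr1 t) _ (hscale z₂ hr2 t) h,
          fun h s => Set.image_mono hsub (h s)⟩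
      rw [heq]
      refine isClosed_iInter fun s => ?_
      have hcl : IsClosed (f '' closedBall 0 r) :=
        ((isCompact_closedBall (0:ℂ) r).image_of_continuousOn
          (hf.continuousOn.mono hsub)).isClosed
      exact hcl.preimage (hWc.comp (Continuous.prodMk_left s))
    · rw [isOpen_iff_eventually]
      intro t ht
      have := isCompact_univ.eventually_forall_of_forall_eventually (x₀ := t)
        (P := fun t s => W t s ∈ f '' ball 0 1)
        fun s _ => hWc.continuousAt.eventually_mem (hO.mem_nhds (ht s))
      filter_upwards [this] with t ht s using ht s trivial
  have huniv := hclopen.eq_univ ⟨0, fun s => ⟨0, by simp, by simp [hW]⟩⟩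
  have h1 : (1 : unitInterval) ∈ {t : unitInterval | ∀ s, W t s ∈ f '' ball 0 1} := by
    rw [huniv]; trivial
  rw [segment_eq_image']
  rintro _ ⟨s, hs, rfl⟩
  simpa [hW] using h1 ⟨s, hs⟩

lemma boundary_derivative_contradiction {α A B C P : ℂ} (hα : 0 ≤ α.re) (hP : 0 < P.re)
    (hE : α * B + A ≠ 0) (hC : α * (C + B) + B = P * (α * B + A))
    (h0 : ((starRingEnd ℂ) A * B).re = 0) {M : ℝ} (hM : M ≤ 0)
    (hMeq : (B - A) * (starRingEnd ℂ) B + (starRingEnd ℂ) A * C = M) : False := by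
  rcases eq_or_ne A 0 with rfl | hA
  · have h1 : Complex.normSq B = M := by
      apply Complex.ofReal_injective
      rw [← hMeq, ← Complex.mul_conj]; simp
    have hB : B ≠ 0 := by rintro rfl; simp at hE
    linarith [Complex.normSq_pos.2 hB]
  · obtain ⟨t, ht⟩ : ∃ t : ℝ, (starRingEnd ℂ) A * B = t * Complex.I :=
      ⟨((starRingEnd ℂ) A * B).im, Complex.ext (by simpa using h0) (by simp)⟩
    have ht' : A * (starRingEnd ℂ) B = -(t * Complex.I) := by
      have := congrArg (starRingEnd ℂ) ht
      simpa using this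
    set a := Complex.normSq A with ha
    have ha0 : 0 < a := Complex.normSq_pos.2 hA
    have haA : A * (starRingEnd ℂ) A = a := Complex.mul_conj A
    set x : ℂ := a + α * t * Complex.I with hx
    have hxE : x = (starRingEnd ℂ) A * (α * B + A) := by
      rw [hx, ← haA]; linear_combination (-α) * ht
    have hx0 : x ≠ 0 := by
      rw [hxE]; exact mul_ne_zero (by simpa using hA) hE
    have key : P * a * x = α * M * a + t * Complex.I * x := by
      have hI := Complex.I_mul_I
      rw [hx] at hxE ⊢
      rw [hxE, ← hMeq]
      have e1 : P * a * ((starRingEnd ℂ) A * (α * B + A))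
          = a * (starRingEnd ℂ) A * (α * (C + B) + B) := by rw [hC]; ring
      rw [e1, ← hxE]
      have hBB : a * (B * (starRingEnd ℂ) B) = (t : ℂ) ^ 2 := by
        rw [← haA]
        linear_combination A * (starRingEnd ℂ) B * ht + t * Complex.I * ht' - (t : ℂ) ^ 2 * hI
      linear_combination a * α * ht + a * ht - α * hBB + α * a * ht' - α * (t : ℂ) ^ 2 * hI
    have h2 : P * a * (Complex.normSq x : ℂ)
        = (M * a : ℝ) * (α * (starRingEnd ℂ) x) + ((t * Complex.normSq x : ℝ) : ℂ) * Complex.I := by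
      push_cast
      rw [← Complex.mul_conj x]
      linear_combination (starRingEnd ℂ) x * key
    have h3 : (α * (starRingEnd ℂ) x).re = a * α.re := by
      simp [hx]; ring
    have h4 := congrArg Complex.re h2
    rw [Complex.add_re, Complex.re_ofReal_mul, Complex.re_ofReal_mul, h3, mul_assoc,
      ← Complex.ofReal_mul, Complex.re_mul_ofReal] at h4
    simp only [Complex.I_re, mul_zero, add_zero] at h4
    have hnx := Complex.normSq_pos.2 hx0
    have h5 : 0 < P.re * (a * Complex.normSq x) := by positivity
    have h6 : M * a * (a * α.re) ≤ 0 := by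
      have : 0 ≤ a * (a * α.re) := by positivity
      nlinarith
    linarith

lemma nonneg_deriv_of_nonneg_right {h : ℝ → ℝ} {d : ℝ} (hd : HasDerivAt h d 0) (h0 : h 0 = 0)
    (hpos : ∀ s > 0, 0 ≤ h s) : 0 ≤ d := by
  have := hd.hasDerivWithinAt (s := Set.Ioi 0)
  rw [hasDerivWithinAt_iff_tendsto_slope' (by simp)] at this
  refine ge_of_tendsto this ?_
  filter_upwards [self_mem_nhdsWithin] with s hs
  have hs' : 0 < s := hs
  rw [slope_def_field, h0]
  have := hpos s hs
  simp only [sub_zero]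
  positivity

/-- A continuous function on the disk that is positive at the origin but not everywhere has a zero
of least modulus, inside which it is positive. -/
lemma exists_boundary_zero {N : ℂ → ℝ} (hN : ContinuousOn N (ball 0 1)) (h0 : 0 < N 0)
    (hne : ∃ z ∈ ball (0:ℂ) 1, N z ≤ 0) :
    ∃ z ∈ ball (0:ℂ) 1, N z = 0 ∧ ∀ w, ‖w‖ < ‖z‖ → 0 < N w := by
  obtain ⟨y, hy, hy0⟩ := hne
  have hy1 : ‖y‖ < 1 := by simpa using hy
  have hsub : closedBall (0:ℂ) ‖y‖ ⊆ ball 0 1 := closedBall_subset_ball hy1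
  have hK : IsCompact (closedBall (0:ℂ) ‖y‖ ∩ N ⁻¹' Set.Iic 0) :=
    (isCompact_closedBall _ _).of_isClosed_subset
      ((hN.mono hsub).preimage_isClosed_of_isClosed isClosed_closedBall isClosed_Iic)
      Set.inter_subset_left
  obtain ⟨z, ⟨hz, hz0⟩, hmin⟩ := hK.exists_isMinOn ⟨y, by simp, hy0⟩ continuous_norm.continuousOn
  have hpos : ∀ w, ‖w‖ < ‖z‖ → 0 < N w := by
    intro w hw
    by_contra! hle
    have hwy : w ∈ closedBall (0:ℂ) ‖y‖ := by
      have : ‖z‖ ≤ ‖y‖ := by simpa using hz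
      simpa using hw.le.trans this
    exact absurd (hmin ⟨hwy, hle⟩) (not_le.2 hw)
  refine ⟨z, hsub hz, le_antisymm hz0 ?_, hpos⟩
  have hzn : z ≠ 0 := by rintro rfl; exact absurd h0 (not_lt.2 hz0)
  have hc : Tendsto (fun s : ℝ => N ((s:ℂ) * z)) (𝓝[<] 1) (𝓝 (N z)) := by
    have h1 : ContinuousAt N (((1:ℝ):ℂ) * z) := by
      simpa using hN.continuousAt (isOpen_ball.mem_nhds (hsub hz))
    have h2 : ContinuousAt (fun s : ℝ => (s:ℂ) * z) 1 := by fun_prop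
    have h3 : ContinuousAt (fun s : ℝ => N ((s:ℂ) * z)) 1 :=
      ContinuousAt.comp (g := N) (f := fun s : ℝ => (s:ℂ) * z) h1 h2
    have h4 : Tendsto (fun s : ℝ => N ((s:ℂ) * z)) (𝓝[<] 1) (𝓝 (N (((1:ℝ):ℂ) * z))) :=
      h3.tendsto.mono_left nhdsWithin_le_nhds
    simpa using h4
  refine ge_of_tendsto hc ?_
  filter_upwards [Ioo_mem_nhdsLT (show (0:ℝ) < 1 by norm_num)] with s hs
  refine (hpos _ ?_).le
  rw [norm_mul, Complex.norm_real, Real.norm_eq_abs, abs_of_pos hs.1]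
  nlinarith [hs.2, norm_pos_iff.2 hzn]

lemma re_pos_of_briotBouquet {α : ℂ} (hα : 0 ≤ α.re) {f : ℂ → ℂ}
    (hf : DifferentiableOn ℂ f (ball 0 1))
    (hode : ∀ z ∈ ball (0:ℂ) 1,
      α * (deriv f z + z * deriv (deriv f) z) + deriv f z = ((1 - z) ^ 2)⁻¹) :
    ∀ z ∈ ball (0:ℂ) 1,
      0 < ((starRingEnd ℂ) (deriv f z) * (deriv f z + z * deriv (deriv f) z)).re := by
  set A := deriv f with hA
  set B : ℂ → ℂ := fun z => A z + z * deriv A z with hB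
  have hne1 : ∀ z ∈ ball (0:ℂ) 1, 1 - z ≠ 0 := by
    intro z hz h
    rw [sub_eq_zero] at h
    simp [← h] at hz
  have hAan : ∀ z ∈ ball (0:ℂ) 1, AnalyticAt ℂ A z := fun z hz =>
    (hf.analyticAt (isOpen_ball.mem_nhds hz)).deriv
  have hBan : ∀ z ∈ ball (0:ℂ) 1, AnalyticAt ℂ B z := fun z hz =>
    (hAan z hz).add (analyticAt_id.mul (hAan z hz).deriv)
  have hNc : ContinuousOn (fun z => ((starRingEnd ℂ) (A z) * B z).re) (ball 0 1) := by
    intro z hz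
    refine (Complex.continuous_re.continuousAt.comp ?_).continuousWithinAt
    exact (Complex.continuous_conj.continuousAt.comp (hAan z hz).continuousAt).mul
      (hBan z hz).continuousAt
  have hN0 : 0 < ((starRingEnd ℂ) (A 0) * B 0).re := by
    have h0 := hode 0 (by simp)
    have hB0 : B 0 = A 0 := by simp [hB]
    have hA0 : A 0 ≠ 0 := by intro h; simp [h] at h0
    rw [hB0, mul_comm, Complex.mul_conj, Complex.ofReal_re]
    exact Complex.normSq_pos.2 hA0
  by_contra! hcon
  obtain ⟨z, hz, hz0, hpos⟩ := exists_boundary_zero hNc hN0 hcon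
  have hE := hode z hz
  have h1z := hne1 z hz
  have hzn : z ≠ 0 := by rintro rfl; exact hN0.ne' hz0
  have hAd := (hAan z hz).differentiableAt.hasDerivAt
  have hBd := (hBan z hz).differentiableAt.hasDerivAt
  set C := z * deriv B z with hC
  have hode' : α * deriv B z + deriv A z = 2 / (1 - z) ^ 3 := by
    have h1 := (hBd.const_mul α).add hAd
    have h2 : HasDerivAt (fun z : ℂ => ((1 - z) ^ 2)⁻¹) (2 / (1 - z) ^ 3) z := by
      have := ((((hasDerivAt_id z).const_sub 1).pow 2).inv (pow_ne_zero 2 h1z))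
      refine this.congr_deriv ?_
      simp
      field_simp
    refine (h1.congr_of_eventuallyEq ?_).unique h2
    filter_upwards [isOpen_ball.mem_nhds hz] with w hw using (hode w hw).symm
  have hzA : z * deriv A z = B z - A z := by simp [hB]
  set M := (B z - A z) * (starRingEnd ℂ) (B z) + (starRingEnd ℂ) (A z) * C with hM
  have hτ : ∀ τ : ℂ, τ.re < 0 → 0 ≤ (τ * M).re := by
    intro τ hτ
    have hγ : HasDerivAt (fun s : ℝ => z * Complex.exp (s * τ)) (z * τ) 0 := by
      have h1 : HasDerivAt (fun s : ℝ => (s : ℂ) * τ) τ 0 := by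
        simpa using (Complex.ofRealCLM.hasDerivAt (x := 0)).mul_const τ
      simpa using h1.cexp.const_mul z
    have hA1 : HasDerivAt (fun s : ℝ => A (z * Complex.exp (s * τ))) (τ * (B z - A z)) 0 := by
      have := hAd.comp_of_eq (0:ℝ) hγ (by simp)
      refine this.congr_deriv ?_
      rw [← hzA]; ring
    have hB1 : HasDerivAt (fun s : ℝ => B (z * Complex.exp (s * τ))) (τ * C) 0 := by
      have := hBd.comp_of_eq (0:ℝ) hγ (by simp)
      refine this.congr_deriv ?_
      rw [hC]; ring
    have hNd : HasDerivAt (fun s : ℝ => inner ℝ (A (z * Complex.exp (s * τ)))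
        (B (z * Complex.exp (s * τ)))) (τ * M).re 0 := by
      refine (hA1.inner ℝ hB1).congr_deriv ?_
      simp only [Complex.inner, Complex.ofReal_zero, zero_mul, Complex.exp_zero, mul_one, hM]
      simp
      ring
    refine nonneg_deriv_of_nonneg_right hNd ?_ ?_
    · simpa [Complex.inner, mul_comm] using hz0
    · intro s hs
      rw [Complex.inner, mul_comm]
      refine (hpos _ ?_).le
      rw [norm_mul, Complex.norm_exp]
      have : Real.exp ((s:ℂ) * τ).re < 1 := by
        rw [Real.exp_lt_one_iff, Complex.re_ofReal_mul]
        nlinarith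
      nlinarith [norm_pos_iff.2 hzn]
  have hMre : M.re ≤ 0 := by
    have := hτ (-1) (by simp)
    simpa using this
  have hMim : M.im = 0 := by
    by_contra hne
    have h1 := hτ ⟨-1, (1 - M.re) / M.im⟩ (by simp)
    rw [Complex.mul_re, div_mul_cancel₀ _ hne] at h1
    simp at h1
    linarith
  have hre : 0 < ((1 + z) / (1 - z)).re := by
    have hnz : ‖z‖ < 1 := by simpa using hz
    have e : (1 + z) / (1 - z)
        = (((Complex.normSq (1 - z))⁻¹ : ℝ) : ℂ) * ((1 + z) * (starRingEnd ℂ) (1 - z)) := by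
      rw [div_eq_mul_inv, Complex.inv_def]; ring
    rw [e, Complex.re_ofReal_mul]
    refine mul_pos (inv_pos.2 (Complex.normSq_pos.2 h1z)) ?_
    have : Complex.normSq z < 1 := by
      rw [Complex.normSq_eq_norm_sq]; nlinarith [norm_nonneg z]
    rw [Complex.normSq_apply] at this
    simp
    nlinarith
  refine boundary_derivative_contradiction (A := A z) (B := B z) (C := C) (M := M.re)
    (P := (1 + z) / (1 - z)) hα hre ?_ ?_ hz0 hMre ?_
  · change α * B z + A z = _ at hE
    rw [hE]; exact inv_ne_zero (pow_ne_zero 2 h1z)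
  · change α * B z + A z = _ at hE
    have h5 : α * C + (B z - A z) = 2 * z / (1 - z) ^ 3 := by
      rw [← hzA, hC]; linear_combination z * hode'
    have h6 : α * (C + B z) + B z = 2 * z / (1 - z) ^ 3 + ((1 - z) ^ 2)⁻¹ := by
      linear_combination h5 + hE
    rw [h6, hE]
    field_simp
    ring
  · exact Complex.ext (by simp [hM]) (hMim.trans (by simp))

/-- The **Noshiro–Warschawski theorem**. -/
theorem injOn_of_re_mul_deriv_pos {F F' : ℂ → ℂ} {H : Set ℂ} (hH : Convex ℝ H) (β : ℂ)
    (hF : ∀ w ∈ H, HasDerivAt F (F' w) w) (hpos : ∀ w ∈ H, 0 < (β * F' w).re) :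
    Set.InjOn F H := by
  intro w₁ h₁ w₂ h₂ heq
  by_contra hne
  have hΔ : w₂ - w₁ ≠ 0 := sub_ne_zero.2 (Ne.symm hne)
  have hmem : ∀ s ∈ Set.Icc (0:ℝ) 1, w₁ + s * (w₂ - w₁) ∈ H := by
    intro s hs
    simpa using hH.add_smul_sub_mem h₁ h₂ hs
  have hd : ∀ s ∈ Set.Icc (0:ℝ) 1,
      HasDerivAt (fun s : ℝ => (β / (w₂ - w₁) * F (w₁ + s * (w₂ - w₁))).re)
        (β * F' (w₁ + s * (w₂ - w₁))).re s := by
    intro s hs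
    have h1 : HasDerivAt (fun s : ℂ => w₁ + s * (w₂ - w₁)) (w₂ - w₁) (s : ℂ) := by
      simpa using ((hasDerivAt_id (s : ℂ)).mul_const (w₂ - w₁)).const_add w₁
    have h2 := (((hF _ (hmem s hs)).comp (s : ℂ) h1).const_mul (β / (w₂ - w₁))).real_of_complex
    refine h2.congr_deriv (congrArg Complex.re ?_)
    field_simp
  have hmono := strictMonoOn_of_deriv_pos (convex_Icc (0:ℝ) 1)
    (fun s hs => (hd s hs).continuousAt.continuousWithinAt)
    (fun s hs => by
      rw [(hd s (interior_subset hs)).deriv]; exact hpos _ (hmem s (interior_subset hs)))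
  have := hmono (by simp) (by simp) (zero_lt_one (α := ℝ))
  simp [heq] at this

/-- A function that is close-to-convex with respect to `z ↦ 1 / (1 - z)` is injective. -/
theorem injOn_ball_of_re_pos {f : ℂ → ℂ} (hf : DifferentiableOn ℂ f (ball 0 1)) (β : ℂ)
    (hpos : ∀ z ∈ ball (0:ℂ) 1,
      0 < (β * deriv f z * (starRingEnd ℂ) (((1 - z) ^ 2)⁻¹)).re) :
    Set.InjOn f (ball 0 1) := by
  set H : Set ℂ := {w | 1 / 2 < w.re} with hH
  have hHc : Convex ℝ H := convex_halfSpace_re_gt _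
  have hw0 : ∀ w ∈ H, w ≠ 0 := by
    rintro w hw rfl
    simp [hH] at hw
    linarith
  have hwb : ∀ w ∈ H, 1 - w⁻¹ ∈ ball (0:ℂ) 1 := by
    intro w hw
    have h0 := hw0 w hw
    have hw' : 1 / 2 < w.re := hw
    have e : 1 - w⁻¹ = (w - 1) / w := by field_simp
    rw [mem_ball_zero_iff, e, norm_div, div_lt_one (norm_pos_iff.2 h0)]
    refine lt_of_pow_lt_pow_left₀ 2 (norm_nonneg _) ?_
    rw [← Complex.normSq_eq_norm_sq, ← Complex.normSq_eq_norm_sq, Complex.normSq_apply,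
      Complex.normSq_apply]
    simp
    nlinarith
  have hinj : Set.InjOn (fun w => f (1 - w⁻¹)) H := by
    refine injOn_of_re_mul_deriv_pos (F' := fun w => deriv f (1 - w⁻¹) * (w ^ 2)⁻¹) hHc β ?_ ?_
    · intro w hw
      have h1 := (hf.differentiableAt (isOpen_ball.mem_nhds (hwb w hw))).hasDerivAt
      have h2 := (hasDerivAt_inv (hw0 w hw)).const_sub 1
      rw [neg_neg] at h2
      exact h1.comp w h2
    · intro w hw
      have h0 := hw0 w hw
      have h := hpos _ (hwb w hw)
      have hn : 0 < Complex.normSq (w ^ 2) := Complex.normSq_pos.2 (pow_ne_zero 2 h0)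
      have e : β * deriv f (1 - w⁻¹) * (starRingEnd ℂ) (((1 - (1 - w⁻¹)) ^ 2)⁻¹)
          = (Complex.normSq (w ^ 2) : ℂ) * (β * (deriv f (1 - w⁻¹) * (w ^ 2)⁻¹)) := by
        have : ((1 - (1 - w⁻¹)) ^ 2)⁻¹ = w ^ 2 := by simp
        rw [this, ← Complex.mul_conj]
        field_simp
      rw [e, Complex.re_ofReal_mul] at h
      exact (pos_iff_pos_of_mul_pos h).1 hn
  have hb : ∀ z ∈ ball (0:ℂ) 1, (1 - z)⁻¹ ∈ H ∧ 1 - ((1 - z)⁻¹)⁻¹ = z := by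
    intro z hz
    refine ⟨?_, by simp⟩
    have hz1 : ‖z‖ < 1 := by simpa using hz
    have hne : 1 - z ≠ 0 := by
      intro h; rw [sub_eq_zero] at h; simp [← h] at hz1
    have hn := Complex.normSq_pos.2 hne
    have h2 : Complex.normSq z < 1 := by
      rw [Complex.normSq_eq_norm_sq]; nlinarith [norm_nonneg z]
    change 1 / 2 < ((1 - z)⁻¹).re
    rw [Complex.inv_re, lt_div_iff₀ hn]
    rw [Complex.normSq_apply] at *
    simp
    nlinarith
  intro z₁ h₁ z₂ h₂ heq
  have := hinj (hb z₁ h₁).1 (hb z₂ h₂).1 (by simpa using heq)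
  simpa using this

section Series

variable {α : ℂ}

lemma one_le_norm_one_add_nat_mul (hα : 0 ≤ α.re) (n : ℕ) :
    1 ≤ ‖1 + (n : ℂ) * α‖ := by
  refine le_trans ?_ (Complex.re_le_norm _)
  have : 0 ≤ (n : ℝ) * α.re := by positivity
  simpa using this

lemma norm_pow_div_le (hα : 0 ≤ α.re) (n : ℕ) (z : ℂ) :
    ‖z ^ n / (1 + (n : ℂ) * α)‖ ≤ ‖z‖ ^ n := by
  rw [norm_div, norm_pow]
  exact div_le_self (by positivity) (one_le_norm_one_add_nat_mul hα n)

lemma tsum_pow_div_eq_integral (hα : 0 ≤ α.re) {z : ℂ} (hz : z ∈ ball (0:ℂ) 1) :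
    ∑' n : ℕ, z ^ n / (1 + (n : ℂ) * α) = ∫ t in (0:ℝ)..1, 1 / (1 - z * (t : ℂ) ^ α) := by
  have hz1 : ‖z‖ < 1 := by simpa using hz
  have hbound : ∀ t ∈ Set.uIoc (0:ℝ) 1, ‖(t : ℂ) ^ α‖ ≤ 1 := by
    intro t ht
    rw [Set.uIoc_of_le zero_le_one] at ht
    rw [Complex.norm_cpow_eq_rpow_re_of_pos ht.1]
    exact Real.rpow_le_one ht.1.le ht.2 hα
  have hsum : HasSum (fun n : ℕ => ∫ t in (0:ℝ)..1, z ^ n * ((t : ℂ) ^ α) ^ n)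
      (∫ t in (0:ℝ)..1, 1 / (1 - z * (t : ℂ) ^ α)) := by
    refine intervalIntegral.hasSum_integral_of_dominated_convergence (fun n _ => ‖z‖ ^ n)
      (fun n => ?_) (fun n => ?_) ?_ ?_ ?_
    · refine Measurable.aestronglyMeasurable ?_
      fun_prop
    · refine Eventually.of_forall fun t ht => ?_
      rw [norm_mul, norm_pow, norm_pow]
      exact mul_le_of_le_one_right (by positivity) (pow_le_one₀ (norm_nonneg _) (hbound t ht))
    · exact Eventually.of_forall fun t _ => summable_geometric_of_lt_one (norm_nonneg _) hz1
    · exact intervalIntegrable_const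
    · refine Eventually.of_forall fun t ht => ?_
      simp only [← mul_pow, one_div]
      refine hasSum_geometric_of_norm_lt_one ?_
      rw [norm_mul]
      exact (mul_le_of_le_one_right (norm_nonneg _) (hbound t ht)).trans_lt hz1
  rw [← hsum.tsum_eq]
  refine tsum_congr fun n => ?_
  have hre : -1 < ((n : ℂ) * α).re := by
    have : 0 ≤ (n : ℝ) * α.re := by positivity
    simp; linarith
  have hne : (n : ℂ) * α + 1 ≠ 0 := by
    intro h
    have := one_le_norm_one_add_nat_mul hα n
    rw [add_comm, h] at this
    simp at this
    linarith
  simp only [← Complex.cpow_nat_mul]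
  rw [intervalIntegral.integral_const_mul, integral_cpow (Or.inl hre)]
  simp [Complex.zero_cpow hne, add_comm, div_eq_mul_inv]

lemma differentiableAt_tsum_pow_div (hα : 0 ≤ α.re) {z : ℂ} (hz : z ∈ ball (0:ℂ) 1) :
    DifferentiableAt ℂ (fun z : ℂ => ∑' n : ℕ, z ^ n / (1 + (n : ℂ) * α)) z ∧
    ∑' n : ℕ, z ^ n / (1 + (n : ℂ) * α)
      + α * (z * deriv (fun z : ℂ => ∑' n : ℕ, z ^ n / (1 + (n : ℂ) * α)) z) = (1 - z)⁻¹ := by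
  have hz1 : ‖z‖ < 1 := by simpa using hz
  obtain ⟨r, hzr, hr⟩ := exists_between hz1
  have hr0 : 0 ≤ r := (norm_nonneg z).trans hzr.le
  have hzU : z ∈ ball (0:ℂ) r := by simpa using hzr
  have hd : ∀ n : ℕ, Differentiable ℂ fun w : ℂ => w ^ n / (1 + (n : ℂ) * α) := by
    intro n; fun_prop
  have hle : ∀ (n : ℕ) (w : ℂ), w ∈ ball (0:ℂ) r → ‖w ^ n / (1 + (n : ℂ) * α)‖ ≤ r ^ n := by
    intro n w hw
    have : ‖w‖ ≤ r := by simpa using (mem_ball_zero_iff.1 hw).le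
    exact (norm_pow_div_le hα n w).trans (pow_le_pow_left₀ (norm_nonneg _) this n)
  have hs := summable_geometric_of_lt_one hr0 hr
  refine ⟨(Complex.differentiableOn_tsum_of_summable_norm hs
    (fun n => (hd n).differentiableOn) isOpen_ball hle).differentiableAt
      (isOpen_ball.mem_nhds hzU), ?_⟩
  have h1 := Complex.hasSum_deriv_of_summable_norm hs (fun n => (hd n).differentiableOn)
    isOpen_ball hle hzU
  have h2 : HasSum (fun n : ℕ => z ^ n / (1 + (n : ℂ) * α))
      (∑' n : ℕ, z ^ n / (1 + (n : ℂ) * α)) :=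
    (Summable.of_norm_bounded hs (fun n => hle n z hzU)).hasSum
  have h3 := h2.add ((h1.mul_left z).mul_left α)
  refine h3.unique ?_
  refine (hasSum_geometric_of_norm_lt_one hz1).congr_fun fun n => ?_
  have hne : 1 + (n : ℂ) * α ≠ 0 := by
    intro h
    have := one_le_norm_one_add_nat_mul hα n
    rw [h] at this
    simp at this
    linarith
  have hdn : deriv (fun w : ℂ => w ^ n / (1 + (n : ℂ) * α)) z
      = n * z ^ (n - 1) / (1 + (n : ℂ) * α) := by
    rw [deriv_div_const]; simp
  rw [hdn]
  rcases n with _ | n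
  · simp
  · simp only [Nat.add_sub_cancel]
    field_simp
    ring

end Series

lemma deriv_deriv_of_add_mul_deriv_eq_inv {α : ℂ} {f : ℂ → ℂ} (hf : DifferentiableOn ℂ f (ball 0 1))
    (hode : ∀ z ∈ ball (0:ℂ) 1, f z + α * (z * deriv f z) = (1 - z)⁻¹)
    {z : ℂ} (hz : z ∈ ball (0:ℂ) 1) :
    α * (deriv f z + z * deriv (deriv f) z) + deriv f z = ((1 - z) ^ 2)⁻¹ := by
  have hne : 1 - z ≠ 0 := by
    intro h; rw [sub_eq_zero] at h; simp [← h] at hz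
  have han := hf.analyticAt (isOpen_ball.mem_nhds hz)
  have h1 := han.differentiableAt.hasDerivAt.add
    (((hasDerivAt_id z).mul han.deriv.differentiableAt.hasDerivAt).const_mul α)
  have h2 := ((hasDerivAt_id z).const_sub 1).inv hne
  have h3 := (h1.congr_of_eventuallyEq (f₁ := fun z => (1 - z)⁻¹) (by
    filter_upwards [isOpen_ball.mem_nhds hz] with w hw using (hode w hw).symm)).unique h2
  simp at h3
  linear_combination h3

/-- For `Re α ≥ 0`, the function `Φ_α(z) = ∫₀¹ dt/(1 - z t^α) = ∑_{n≥0} z^n/(1+nα)` is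
convex univalent on the unit disk. -/
theorem Phi_alpha_convex (α : ℂ) (hα : 0 ≤ α.re) (Φ : ℂ → ℂ)
    (hΦ : ∀ z ∈ ball (0:ℂ) 1, Φ z = ∑' n : ℕ, z ^ n / (1 + (n : ℂ) * α)) :
    (∀ z ∈ ball (0:ℂ) 1, Φ z = ∫ t in (0:ℝ)..1, 1 / (1 - z * (t : ℂ) ^ α)) ∧
    DifferentiableOn ℂ Φ (ball 0 1) ∧
    Set.InjOn Φ (ball 0 1) ∧
    Convex ℝ (Φ '' ball 0 1) := by
  have hev : ∀ z ∈ ball (0:ℂ) 1,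
      Φ =ᶠ[𝓝 z] fun z => ∑' n : ℕ, z ^ n / (1 + (n : ℂ) * α) := fun z hz => by
    filter_upwards [isOpen_ball.mem_nhds hz] with w hw using hΦ w hw
  have hf : DifferentiableOn ℂ Φ (ball 0 1) := fun z hz =>
    ((differentiableAt_tsum_pow_div hα hz).1.congr_of_eventuallyEq
      (hev z hz)).differentiableWithinAt
  have hode : ∀ z ∈ ball (0:ℂ) 1, Φ z + α * (z * deriv Φ z) = (1 - z)⁻¹ := fun z hz => by
    rw [(hev z hz).deriv_eq, hΦ z hz]
    exact (differentiableAt_tsum_pow_div hα hz).2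
  have hode' := fun z hz => deriv_deriv_of_add_mul_deriv_eq_inv hf hode (z := z) hz
  have hp := re_pos_of_briotBouquet hα hf hode'
  have hinj : Set.InjOn Φ (ball 0 1) := by
    refine injOn_ball_of_re_pos hf (if α = 0 then 1 else α) fun z hz => ?_
    have hA : deriv Φ z ≠ 0 := by
      intro h; simpa [h] using hp z hz
    rw [← hode' z hz]
    split_ifs with h0
    · rw [h0, zero_mul, zero_add, one_mul, Complex.mul_conj, Complex.ofReal_re]
      exact Complex.normSq_pos.2 hA
    · have h1 := mul_pos (Complex.normSq_pos.2 h0) (hp z hz)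
      have h2 := mul_nonneg (Complex.normSq_nonneg (deriv Φ z)) hα
      set A := deriv Φ z
      set B := A + z * deriv (deriv Φ) z
      have e : α * A * (starRingEnd ℂ) (α * B + A)
          = (Complex.normSq α : ℂ) * (starRingEnd ℂ) ((starRingEnd ℂ) A * B)
            + (Complex.normSq A : ℂ) * α := by
        rw [← Complex.mul_conj, ← Complex.mul_conj]
        simp only [map_add, map_mul, Complex.conj_conj]
        ring
      rw [e, Complex.add_re, Complex.re_ofReal_mul, Complex.re_ofReal_mul, Complex.conj_re]
      linarith
  exact ⟨fun z hz => (hΦ z hz).trans (tsum_pow_div_eq_integral hα hz), hf, hinj,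
    convex_image_ball_of_re_pos hf hinj hp⟩
end
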